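/- Interior exponential decay under a uniformly positive potential (classical-solution form): Let Ω ⊂ ℝⁿ be a bounded open set, let K₀ be a compact set and U an open set with K₀ ⊂ U and cl(U) ⊂ Ω. Then there exist constants C > 0 and c > 0, depending only on n, K₀ and U, with the following property: for every ε > 0, every q₀ > 0, every function q : Ω → ℝ with q(x) ≥ 0 for all x ∈ Ω and q(x) ≥ q₀ for all x ∈ U, and every z : cl(Ω) → ℝ that is continuous on cl(Ω), twice continuously differentiable on Ω, and satisfies Δz(x) = (q(x)/ε) z(x) for all x ∈ Ω, one has sup_{x ∈ K₀} |z(x)| ≤ C (sup_{x ∈ ∂Ω} |z(x)|) · exp(−c √(q₀/ε)). -/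

import Mathlib

open scoped BigOperators

/-- The Laplacian of `z : ℝⁿ → ℝ`: the sum of the second partial derivatives
`Σᵢ ∂²z/∂xᵢ²` at `x`. -/
noncomputable def lap {n : ℕ} (z : EuclideanSpace ℝ (Fin n) → ℝ)
    (x : EuclideanSpace ℝ (Fin n)) : ℝ :=
  ∑ i : Fin n,
    fderiv ℝ (fun y => fderiv ℝ z y (EuclideanSpace.single i 1)) x
      (EuclideanSpace.single i 1)

lemma differentiableAt_fderiv_apply {E : Type*} [NormedAddCommGroup E] [NormedSpace ℝ E]
    {f : E → ℝ} {x : E} (hf : ContDiffAt ℝ 2 f x) (e : E) :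
    DifferentiableAt ℝ (fun y => fderiv ℝ f y e) x :=
  ((hf.fderiv_right (m := 1) (by norm_num)).differentiableAt (by norm_num)).clm_apply
    (differentiableAt_const e)

lemma eventually_differentiableAt {E : Type*} [NormedAddCommGroup E] [NormedSpace ℝ E]
    {f : E → ℝ} {x : E} (hf : ContDiffAt ℝ 2 f x) :
    ∀ᶠ y in nhds x, DifferentiableAt ℝ f y :=
  (hf.eventually (by norm_num)).mono fun _ hy => hy.differentiableAt (by norm_num)

lemma lap_add {n : ℕ} {f g : EuclideanSpace ℝ (Fin n) → ℝ} {x : EuclideanSpace ℝ (Fin n)}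
    (hf : ContDiffAt ℝ 2 f x) (hg : ContDiffAt ℝ 2 g x) :
    lap (fun y => f y + g y) x = lap f x + lap g x := by
  unfold lap
  rw [← Finset.sum_add_distrib]
  refine Finset.sum_congr rfl fun i _ => ?_
  have h : (fun y => fderiv ℝ (fun y => f y + g y) y (EuclideanSpace.single i 1)) =ᶠ[nhds x]
      fun y => fderiv ℝ f y (EuclideanSpace.single i 1) +
        fderiv ℝ g y (EuclideanSpace.single i 1) := by
    filter_upwards [eventually_differentiableAt hf, eventually_differentiableAt hg] with y h1 h2
    rw [fderiv_fun_add h1 h2]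
    rfl
  rw [h.fderiv_eq, fderiv_fun_add (differentiableAt_fderiv_apply hf _)
    (differentiableAt_fderiv_apply hg _)]
  rfl

lemma lap_neg {n : ℕ} (f : EuclideanSpace ℝ (Fin n) → ℝ) (x : EuclideanSpace ℝ (Fin n)) :
    lap (fun y => -f y) x = -lap f x := by
  simp [lap, fderiv_fun_neg]

/-- A separated function `y ↦ a + Σᵢ φᵢ(yᵢ)` has Laplacian `Σᵢ φᵢ''(yᵢ)`. -/
lemma lap_const_add_sum {n : ℕ} (a : ℝ) {φ φ' φ'' : Fin n → ℝ → ℝ}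
    (h1 : ∀ i t, HasDerivAt (φ i) (φ' i t) t) (h2 : ∀ i t, HasDerivAt (φ' i) (φ'' i t) t)
    (x : EuclideanSpace ℝ (Fin n)) :
    lap (fun y => a + ∑ i, φ i (y i)) x = ∑ i, φ'' i (x i) := by
  have hp (i : Fin n) (y : EuclideanSpace ℝ (Fin n)) :
      HasFDerivAt (fun y : EuclideanSpace ℝ (Fin n) => y i)
        (EuclideanSpace.proj i : EuclideanSpace ℝ (Fin n) →L[ℝ] ℝ) y :=
    (EuclideanSpace.proj i : EuclideanSpace ℝ (Fin n) →L[ℝ] ℝ).hasFDerivAt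
  have hd (y : EuclideanSpace ℝ (Fin n)) (j : Fin n) :
      fderiv ℝ (fun y : EuclideanSpace ℝ (Fin n) => a + ∑ i, φ i (y i)) y
        (EuclideanSpace.single j 1) = φ' j (y j) := by
    have := (HasFDerivAt.fun_sum (u := Finset.univ) fun i _ =>
      (h1 i (y i)).comp_hasFDerivAt y (hp i y)).const_add a
    rw [HasFDerivAt.fderiv (f := fun y : EuclideanSpace ℝ (Fin n) => a + ∑ i, φ i (y i)) this]
    simp
  unfold lap
  refine Finset.sum_congr rfl fun j _ => ?_
  simp_rw [hd]
  have := (h2 j (x j)).comp_hasFDerivAt x (hp j x)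
  rw [HasFDerivAt.fderiv (f := fun y : EuclideanSpace ℝ (Fin n) => φ' j (y j)) this]
  simp

lemma IsLocalMax.fderiv_fderiv_nonpos {E : Type*} [NormedAddCommGroup E] [NormedSpace ℝ E]
    {f : E → ℝ} {p : E} (hmax : IsLocalMax f p) (hf : ContDiffAt ℝ 2 f p) (e : E) :
    fderiv ℝ (fun y => fderiv ℝ f y e) p e ≤ 0 := by
  by_contra! hpos
  have hl (t : ℝ) : HasDerivAt (fun t : ℝ => p + t • e) e t := by
    simpa using ((hasDerivAt_id t).smul_const e).const_add p
  have hc : Filter.Tendsto (fun t : ℝ => p + t • e) (nhds 0) (nhds p) := by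
    simpa using (hl 0).continuousAt.tendsto
  have hd : deriv (fun t : ℝ => f (p + t • e)) =ᶠ[nhds 0] fun t => fderiv ℝ f (p + t • e) e := by
    filter_upwards [hc.eventually (eventually_differentiableAt hf)] with t ht
    exact (ht.hasFDerivAt.comp_hasDerivAt t (hl t)).deriv
  have hdd : deriv (deriv fun t : ℝ => f (p + t • e)) 0
      = fderiv ℝ (fun y => fderiv ℝ f y e) p e := by
    rw [hd.deriv_eq]
    have h : HasFDerivAt (fun y => fderiv ℝ f y e) (fderiv ℝ (fun y => fderiv ℝ f y e) p)
        (p + (0 : ℝ) • e) := by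
      simpa using (differentiableAt_fderiv_apply hf e).hasFDerivAt
    exact (h.comp_hasDerivAt (0 : ℝ) (hl 0)).deriv
  have hmax' : IsLocalMax (fun t : ℝ => f (p + t • e)) 0 := by
    have := hc.eventually hmax
    simpa [IsLocalMax, IsMaxFilter] using this
  have hmin : IsLocalMin (fun t : ℝ => f (p + t • e)) 0 := by
    refine isLocalMin_of_deriv_deriv_pos (hdd ▸ hpos) hmax'.deriv_eq_zero ?_
    have h : ContinuousAt f (p + (0 : ℝ) • e) := by simpa using hf.continuousAt
    exact h.comp_of_eq (hl 0).continuousAt rfl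
  have hconst : (fun t : ℝ => f (p + t • e)) =ᶠ[nhds 0] fun _ => f (p + (0 : ℝ) • e) := by
    filter_upwards [hmax', hmin] with t h h' using le_antisymm h h'
  have := hconst.deriv.deriv_eq
  simp only [deriv_const'] at this
  linarith [hdd ▸ this]

/-- Weak maximum principle: a function which is subharmonic where it is positive and nonpositive on
the boundary is nonpositive. -/
lemma nonpos_of_lap_nonneg {n : ℕ} (hn : 0 < n) {D : Set (EuclideanSpace ℝ (Fin n))}
    (hD : IsOpen D) (hDb : Bornology.IsBounded D) {v : EuclideanSpace ℝ (Fin n) → ℝ}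
    (hvc : ContinuousOn v (closure D)) (hv : ContDiffOn ℝ 2 v D)
    (hfr : ∀ y ∈ frontier D, v y ≤ 0) (hlap : ∀ y ∈ D, 0 < v y → 0 ≤ lap v y)
    {x : EuclideanSpace ℝ (Fin n)} (hx : x ∈ D) : v x ≤ 0 := by
  by_contra! hpos
  have hK : IsCompact (closure D) := hDb.isCompact_closure
  set s : EuclideanSpace ℝ (Fin n) → ℝ := fun y => ∑ i, y i ^ 2
  have hs : ContDiff ℝ 2 s := by fun_prop
  have hs0 (y) : 0 ≤ s y := Finset.sum_nonneg fun i _ => sq_nonneg _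
  obtain ⟨R, hR⟩ := hK.bddAbove_image hs.continuous.continuousOn
  have hR' : ∀ y ∈ closure D, s y ≤ R := fun y hy => hR ⟨y, hy, rfl⟩
  have hR0 : 0 ≤ R := (hs0 x).trans (hR' x (subset_closure hx))
  obtain ⟨δ, hδ, hδR⟩ : ∃ δ > 0, δ * R < v x := by
    refine ⟨v x / (R + 1), by positivity, ?_⟩
    rw [div_mul_eq_mul_div, div_lt_iff₀ (by positivity)]
    nlinarith
  obtain ⟨p, hp, hpmax⟩ := hK.exists_isMaxOn ⟨x, subset_closure hx⟩
    (hvc.add (continuous_const.mul hs.continuous).continuousOn : ContinuousOn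
      (fun y => v y + δ * s y) (closure D))
  have hvp : 0 < v p := by
    have h1 : v x + δ * s x ≤ v p + δ * s p := hpmax (subset_closure hx)
    have h2 := mul_le_mul_of_nonneg_left (hR' p hp) hδ.le
    have h3 := mul_nonneg hδ.le (hs0 x)
    linarith
  have hpD : p ∈ D := by
    by_contra h
    exact (hfr p ⟨hp, by rwa [hD.interior_eq]⟩).not_gt hvp
  have hvC := hv.contDiffAt (hD.mem_nhds hpD)
  have hsC : ContDiffAt ℝ 2 (fun y => δ * s y) p := (contDiff_const.mul hs).contDiffAt
  have hloc : IsLocalMax (fun y => v y + δ * s y) p :=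
    (hpmax.on_subset subset_closure).isLocalMax (hD.mem_nhds hpD)
  have hle : lap (fun y => v y + δ * s y) p ≤ 0 :=
    Finset.sum_nonpos fun i _ => hloc.fderiv_fderiv_nonpos (hvC.add hsC) _
  have hls : lap (fun y => δ * s y) p = ∑ _i : Fin n, δ * 2 := by
    have := lap_const_add_sum 0 (φ := fun (_ : Fin n) t => δ * t ^ 2)
      (φ' := fun _ t => δ * (2 * t)) (φ'' := fun _ _ => δ * 2)
      (fun i t => by simpa using (hasDerivAt_pow 2 t).const_mul δ)
      (fun i t => by simpa using ((hasDerivAt_id t).const_mul 2).const_mul δ) p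
    simpa [s, Finset.mul_sum] using this
  rw [lap_add hvC hsC, hls] at hle
  have h0 := hlap p hpD hvp
  have : 0 < (n : ℝ) * (δ * 2) := by positivity
  simp only [Finset.sum_const, Finset.card_univ, Fintype.card_fin, nsmul_eq_mul] at hle
  linarith

/-- Comparison with a constant: a solution of `Δz = V z` with `V ≥ 0` is bounded by any upper bound
`M ≥ 0` of its boundary values. -/
lemma le_of_lap_eq_mul {n : ℕ} (hn : 0 < n) {Ω : Set (EuclideanSpace ℝ (Fin n))}
    (hΩ : IsOpen Ω) (hΩb : Bornology.IsBounded Ω) {V z : EuclideanSpace ℝ (Fin n) → ℝ}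
    (hV : ∀ y ∈ Ω, 0 ≤ V y) (hzc : ContinuousOn z (closure Ω)) (hz : ContDiffOn ℝ 2 z Ω)
    (hlap : ∀ y ∈ Ω, lap z y = V y * z y) {M : ℝ} (hM : 0 ≤ M)
    (hfr : ∀ y ∈ frontier Ω, z y ≤ M) {x : EuclideanSpace ℝ (Fin n)} (hx : x ∈ closure Ω) :
    z x ≤ M := by
  by_cases hxΩ : x ∈ Ω
  · have := nonpos_of_lap_nonneg hn hΩ hΩb (v := fun y => z y + -M) (by fun_prop) (by fun_prop)
      (fun y hy => by linarith [hfr y hy]) (fun y hy hpos => ?_) hxΩ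
    · linarith
    · have hc : lap (fun _ : EuclideanSpace ℝ (Fin n) => -M) y = 0 := by simp [lap]
      rw [lap_add (hz.contDiffAt (hΩ.mem_nhds hy)) contDiffAt_const, hc, hlap y hy, add_zero]
      exact mul_nonneg (hV y hy) (by linarith)
  · exact hfr x ⟨hx, by rwa [hΩ.interior_eq]⟩

lemma exists_le_abs_sub_of_dist_eq {n : ℕ} {x y : EuclideanSpace ℝ (Fin n)} {r : ℝ} (hr : 0 < r)
    (h : dist y x = r) : ∃ i, r / (n + 1) ≤ |y i - x i| := by
  by_contra! hlt
  have h1 : dist y x ≤ ∑ i, |y i - x i| := by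
    rw [EuclideanSpace.dist_eq]
    refine Real.sqrt_le_iff.2 ⟨Finset.sum_nonneg fun i _ => abs_nonneg _, ?_⟩
    simpa [Real.dist_eq] using Finset.sum_sq_le_sq_sum_of_nonneg (s := Finset.univ)
      (f := fun i => |y i - x i|) fun i _ => abs_nonneg _
  have h2 : ∑ i, |y i - x i| ≤ ∑ _i : Fin n, r / (n + 1) :=
    Finset.sum_le_sum fun i _ => (hlt i).le
  simp only [Finset.sum_const, Finset.card_univ, Fintype.card_fin, nsmul_eq_mul] at h2
  have h3 : (n : ℝ) * (r / (n + 1)) < r := by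
    rw [mul_div_assoc', div_lt_iff₀ (by positivity)]
    nlinarith
  linarith

/-- Comparison on a ball with the barrier `Σᵢ cosh(k(yᵢ - xᵢ))`. -/
lemma le_exp_of_lap_eq_mul {n : ℕ} (hn : 0 < n) {x : EuclideanSpace ℝ (Fin n)} {r k M : ℝ}
    (hr : 0 < r) (hk : 0 ≤ k) (hM : 0 ≤ M) {V z : EuclideanSpace ℝ (Fin n) → ℝ}
    (hV : ∀ y ∈ Metric.ball x r, k ^ 2 ≤ V y) (hzc : ContinuousOn z (Metric.closedBall x r))
    (hz : ContDiffOn ℝ 2 z (Metric.ball x r))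
    (hlap : ∀ y ∈ Metric.ball x r, lap z y = V y * z y)
    (hle : ∀ y ∈ Metric.sphere x r, z y ≤ M) :
    z x ≤ 2 * n * M * Real.exp (-(r / (n + 1)) * k) := by
  set A : ℝ := 2 * M * Real.exp (-(r / (n + 1)) * k)
  have hA : 0 ≤ A := by positivity
  set w : EuclideanSpace ℝ (Fin n) → ℝ := fun y => ∑ i, -A * Real.cosh (k * (y i - x i))
  have hw : ContDiff ℝ 2 w := by
    refine ContDiff.sum fun i _ => contDiff_const.mul (Real.contDiff_cosh.comp ?_)
    fun_prop
  have hw0 (y) : w y ≤ 0 :=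
    Finset.sum_nonpos fun i _ => by nlinarith [Real.cosh_pos (k * (y i - x i))]
  have hlw (y) : lap w y = k ^ 2 * w y := by
    have hd (c t : ℝ) : HasDerivAt (fun t => k * (t - c)) k t := by
      simpa using ((hasDerivAt_id t).sub_const c).const_mul k
    have := lap_const_add_sum 0 (φ := fun i t => -A * Real.cosh (k * (t - x i)))
      (φ' := fun i t => -A * (Real.sinh (k * (t - x i)) * k))
      (φ'' := fun i t => -A * (Real.cosh (k * (t - x i)) * k * k))
      (fun i t => (hd _ t).cosh.const_mul _)
      (fun i t => ((hd _ t).sinh.mul_const k).const_mul _) y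
    simp only [zero_add] at this
    rw [this, Finset.mul_sum]
    exact Finset.sum_congr rfl fun i _ => by ring
  have key := nonpos_of_lap_nonneg hn Metric.isOpen_ball Metric.isBounded_ball
    (v := fun y => z y + w y)
    ((hzc.mono Metric.closure_ball_subset_closedBall).add hw.continuous.continuousOn)
    (hz.add hw.contDiffOn) (fun y hy => ?_) (fun y hy hpos => ?_) (Metric.mem_ball_self hr)
  · simp only [w, sub_self, mul_zero, Real.cosh_zero, mul_one, Finset.sum_const, Finset.card_univ,
      Fintype.card_fin, nsmul_eq_mul] at key
    linear_combination key
  · rw [frontier_ball x hr.ne'] at hy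
    obtain ⟨i, hi⟩ := exists_le_abs_sub_of_dist_eq hr (Metric.mem_sphere.1 hy)
    have h1 : w y ≤ -A * Real.cosh (k * (y i - x i)) := by
      have := Finset.single_le_sum (s := Finset.univ)
        (f := fun i => A * Real.cosh (k * (y i - x i)))
        (fun i _ => mul_nonneg hA (Real.cosh_pos _).le) (Finset.mem_univ i)
      simp only [w, neg_mul, Finset.sum_neg_distrib]
      linarith
    have h2 : Real.exp (r / (n + 1) * k) / 2 ≤ Real.cosh (k * (y i - x i)) := by
      rw [← Real.cosh_abs, abs_mul, abs_of_nonneg hk, Real.cosh_eq]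
      have : Real.exp (r / (n + 1) * k) ≤ Real.exp (k * |y i - x i|) :=
        Real.exp_le_exp.2 (by nlinarith)
      linarith [Real.exp_pos (-(k * |y i - x i|))]
    have h3 : A * (Real.exp (r / (n + 1) * k) / 2) = M := by
      have : Real.exp (-(r / (n + 1)) * k) * Real.exp (r / (n + 1) * k) = 1 := by
        rw [← Real.exp_add]
        simp
      linear_combination M * this
    linarith [mul_le_mul_of_nonneg_left h2 hA, hle y hy]
  · have hwy := hw0 y
    rw [lap_add (hz.contDiffAt (Metric.isOpen_ball.mem_nhds hy)) hw.contDiffAt, hlw, hlap y hy]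
    nlinarith [mul_nonneg (sub_nonneg.2 (hV y hy)) (by linarith : 0 ≤ z y),
      mul_nonneg (sq_nonneg k) hpos.le]

/-- interior exponential decay under a uniformly positive potential
(classical-solution form): given a compact set `K₀` and an open set `U ⊇ K₀`,
there exist `C, c > 0` depending only on `n, K₀, U` such that, for every bounded
open `Ω ⊇ cl(U)`, every `ε > 0`, `q₀ > 0`, every potential `q ≥ 0` on `Ω` with
`q ≥ q₀` on `U`, and every classical solution `z` of `Δz = (q/ε)z` in `Ω`
continuous up to the boundary,
`sup_{K₀} |z| ≤ C (sup_{∂Ω} |z|) exp(−c √(q₀/ε))`. -/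
theorem stmt_12 {n : ℕ} (K₀ U : Set (EuclideanSpace ℝ (Fin n)))
    (hK₀ : IsCompact K₀) (hU : IsOpen U) (hK₀U : K₀ ⊆ U) :
    ∃ C > (0 : ℝ), ∃ c > (0 : ℝ),
      ∀ Ω : Set (EuclideanSpace ℝ (Fin n)), IsOpen Ω → Bornology.IsBounded Ω →
        closure U ⊆ Ω →
        ∀ ε > (0 : ℝ), ∀ q₀ > (0 : ℝ), ∀ q : EuclideanSpace ℝ (Fin n) → ℝ,
          (∀ x ∈ Ω, 0 ≤ q x) → (∀ x ∈ U, q₀ ≤ q x) →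
          ∀ z : EuclideanSpace ℝ (Fin n) → ℝ,
            ContinuousOn z (closure Ω) → ContDiffOn ℝ 2 z Ω →
            (∀ x ∈ Ω, lap z x = q x / ε * z x) →
            ∀ x ∈ K₀,
              |z x| ≤ C * (⨆ y : frontier Ω, |z y.1|) *
                Real.exp (-c * Real.sqrt (q₀ / ε)) := by
  obtain ⟨r, hr, hrU⟩ := hK₀.exists_cthickening_subset_open hU hK₀U
  refine ⟨2 * n + 1, by positivity, r / (n + 1), by positivity, ?_⟩
  intro Ω hΩ hΩb hUΩ ε hε q₀ hq₀ q hq hqU z hzc hz hlap x hx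
  set M : ℝ := ⨆ y : frontier Ω, |z y.1|
  have hM : 0 ≤ M := Real.iSup_nonneg fun _ => abs_nonneg _
  have hxΩ : x ∈ Ω := hUΩ (subset_closure (hK₀U hx))
  rcases Nat.eq_zero_or_pos n with rfl | hn
  · have h := hlap x hxΩ
    have hqx : 0 < q x / ε := div_pos (hq₀.trans_le (hqU x (hK₀U hx))) hε
    have hz0 : z x = 0 := by simpa [lap, hqx.ne'] using h.symm
    rw [hz0, abs_zero]
    positivity
  have hfr : ∀ y ∈ frontier Ω, |z y| ≤ M := by
    have hc : IsCompact (frontier Ω) :=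
      hΩb.isCompact_closure.of_isClosed_subset isClosed_frontier frontier_subset_closure
    obtain ⟨B, hB⟩ := hc.bddAbove_image (hzc.mono frontier_subset_closure).abs
    exact fun y hy => le_ciSup (f := fun y : frontier Ω => |z y.1|)
      ⟨B, by rintro _ ⟨w, rfl⟩; exact hB ⟨w, w.2, rfl⟩⟩ ⟨y, hy⟩
  have hballU : Metric.closedBall x r ⊆ U :=
    (Metric.closedBall_subset_cthickening hx r).trans hrU
  have hballΩ : Metric.closedBall x r ⊆ Ω := (hballU.trans subset_closure).trans hUΩ
  have bound (u : EuclideanSpace ℝ (Fin n) → ℝ) (huc : ContinuousOn u (closure Ω))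
      (hu : ContDiffOn ℝ 2 u Ω) (hulap : ∀ y ∈ Ω, lap u y = q y / ε * u y)
      (hufr : ∀ y ∈ frontier Ω, u y ≤ M) :
      u x ≤ 2 * n * M * Real.exp (-(r / (n + 1)) * √(q₀ / ε)) := by
    refine le_exp_of_lap_eq_mul hn (V := fun y => q y / ε) hr (Real.sqrt_nonneg _) hM
      (fun y hy => ?_) (huc.mono (hballΩ.trans subset_closure))
      (hu.mono (Metric.ball_subset_closedBall.trans hballΩ))
      (fun y hy => hulap y (hballΩ (Metric.ball_subset_closedBall hy)))
      fun y hy => le_of_lap_eq_mul hn hΩ hΩb (V := fun y => q y / ε)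
        (fun y hy => div_nonneg (hq y hy) hε.le) huc hu hulap hM hufr
        (subset_closure (hballΩ (Metric.sphere_subset_closedBall hy)))
    rw [Real.sq_sqrt (by positivity)]
    exact div_le_div_of_nonneg_right (hqU y (hballU (Metric.ball_subset_closedBall hy))) hε.le
  have h1 := bound z hzc hz hlap fun y hy => (le_abs_self _).trans (hfr y hy)
  have h2 := bound (fun y => -z y) hzc.neg hz.neg
    (fun y hy => by rw [lap_neg, hlap y hy]; ring) fun y hy => (neg_le_abs _).trans (hfr y hy)
  have h3 : 0 ≤ M * Real.exp (-(r / (n + 1)) * √(q₀ / ε)) := by positivity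
  exact abs_le'.2 ⟨by linarith, by linarith⟩
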